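/- Let M₁, …, M_a be positive integers and n ≥ 0. Over a field k of characteristic zero, there exist homogeneous polynomials g₁, …, g_a ∈ k[x₀, …, x_n] with deg g_i = M_i such that the projective variety Proj k[x₀,…,x_n, v₁,…,v_a] / (v₁^{M₁} − g₁, …, v_a^{M_a} − g_a) is smooth over k of dimension n. -/

import Mathlib

universe u

/-- An injective integral extension of rings preserves the Krull dimension. -/
theorem RingHom.IsIntegral.ringKrullDim_eq {R S : Type*} [CommRing R] [CommRing S]
    {f : R →+* S} (hf : f.IsIntegral) (hinj : Function.Injective f) :
    ringKrullDim S = ringKrullDim R := by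
  algebraize [f]
  have : FaithfulSMul R S := (faithfulSMul_iff_algebraMap_injective R S).mpr hinj
  apply le_antisymm
  · refine Order.krullDim_le_of_strictMono (PrimeSpectrum.comap (algebraMap R S)) ?_
    intro p q hpq
    exact Ideal.IsIntegral.comap_lt_comap hpq
  · refine iSup_le fun l ↦ ?_
    obtain ⟨P, hP⟩ := Algebra.IsIntegral.comap_surjective R S l.head
    have : P.asIdeal.LiesOver l.head.asIdeal := ⟨by rw [← hP]; rfl⟩
    obtain ⟨L, hL, -⟩ := Ideal.exists_ltSeries_of_hasGoingUp l P.asIdeal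
    exact hL ▸ le_iSup (fun p : LTSeries (PrimeSpectrum S) ↦ (p.length : WithBot ℕ∞)) L

open MvPolynomial in
/-- **Jacobian criterion**: a finitely presented algebra whose Jacobian matrix has a right inverse
is smooth. -/
theorem Algebra.Smooth.of_jacobian_mul_eq_one {k : Type*} [CommRing k] {ι τ : Type*}
    [Fintype ι] [Fintype τ] [DecidableEq ι] (f : ι → MvPolynomial τ k)
    {I : Ideal (MvPolynomial τ k)} (hI : I = Ideal.span (Set.range f))
    (N : Matrix τ ι (MvPolynomial τ k ⧸ I))
    (hN : Matrix.of (fun s b ↦ Ideal.Quotient.mk I (pderiv b (f s))) * N = 1) :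
    Algebra.Smooth k (MvPolynomial τ k ⧸ I) := by
  have hfp : Algebra.FinitePresentation k (MvPolynomial τ k ⧸ I) :=
    Algebra.FinitePresentation.quotient (hI ▸ Submodule.fg_span (Set.finite_range f))
  refine ⟨?_, hfp⟩
  rw [Algebra.FormallySmooth.iff_split_injection (P := MvPolynomial τ k)
    Ideal.Quotient.mk_surjective]
  have hker : RingHom.ker (algebraMap (MvPolynomial τ k) (MvPolynomial τ k ⧸ I)) = I :=
    Ideal.mk_ker
  have hmem (r : ι) :
      f r ∈ RingHom.ker (algebraMap (MvPolynomial τ k) (MvPolynomial τ k ⧸ I)) := by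
    rw [hker, hI]; exact Ideal.subset_span ⟨r, rfl⟩
  choose N' hN' using fun b r ↦ Ideal.Quotient.mk_surjective (N b r)
  let c (r : ι) := Ideal.toCotangent
    (RingHom.ker (algebraMap (MvPolynomial τ k) (MvPolynomial τ k ⧸ I))) ⟨f r, hmem r⟩
  let l₀ := (KaehlerDifferential.mvPolynomialBasis k τ).constr (MvPolynomial τ k)
    (fun b ↦ ∑ r, N' b r • c r)
  have hkill {p : MvPolynomial τ k} (hp : p ∈ I) (x : (RingHom.ker (algebraMap (MvPolynomial τ k)
      (MvPolynomial τ k ⧸ I))).Cotangent) : p • x = 0 :=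
    Ideal.Cotangent.smul_eq_zero_of_mem (by rwa [hker]) x
  have hl₀ (x) : l₀ (KaehlerDifferential.D k _ x) = ∑ b, pderiv b x • ∑ r, N' b r • c r := by
    simp [l₀, Module.Basis.constr_apply_fintype]
  have hD (x) (hx : x ∈ Submodule.span (MvPolynomial τ k) (Set.range f))
      (hx' : x ∈ RingHom.ker (algebraMap (MvPolynomial τ k) (MvPolynomial τ k ⧸ I))) :
      l₀ (KaehlerDifferential.D k _ x) = Ideal.toCotangent _ ⟨x, hx'⟩ := by
    induction hx using Submodule.span_induction with
    | mem x hx =>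
      obtain ⟨s, rfl⟩ := hx
      have key (r : ι) : (∑ b, pderiv b (f s) * N' b r) • c r = if s = r then c r else 0 := by
        have h := congrFun (congrFun hN s) r
        rw [Matrix.mul_apply, Matrix.one_apply] at h
        simp only [Matrix.of_apply, ← hN', ← map_mul, ← map_sum] at h
        have h2 : (∑ b, pderiv b (f s) * N' b r) - (if s = r then 1 else 0) ∈ I := by
          rw [← Ideal.Quotient.mk_eq_mk_iff_sub_mem, h]; split_ifs <;> simp
        have h3 := hkill h2 (c r)
        rw [sub_smul, sub_eq_zero] at h3
        rw [h3]; split_ifs <;> simp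
      rw [hl₀]
      simp only [Finset.smul_sum, smul_smul]
      rw [Finset.sum_comm]
      simp only [← Finset.sum_smul, key]
      simp [c]
    | zero => simp; exact (map_zero _).symm
    | add x y hx hy ihx ihy =>
      rw [← Ideal.span, ← hI, ← hker] at hx hy
      rw [map_add, map_add, ihx hx, ihy hy, ← map_add]; rfl
    | smul p x hx ih =>
      rw [← Ideal.span, ← hI] at hx
      have hx'' := hx
      rw [← hker] at hx''
      have h : KaehlerDifferential.D k (MvPolynomial τ k) (p • x) =
          p • KaehlerDifferential.D k _ x + x • KaehlerDifferential.D k _ p := Derivation.leibniz _ _ _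
      rw [h, map_add, map_smul, map_smul, hkill hx, add_zero, ih hx'', ← map_smul]; rfl
  refine ⟨_root_.TensorProduct.lift (Submodule.liftQ I (LinearMap.toSpanSingleton _ _ l₀) ?_), ?_⟩
  · intro p hp
    rw [LinearMap.mem_ker]
    refine LinearMap.ext fun x ↦ ?_
    simpa using hkill hp _
  · ext x
    obtain ⟨x, rfl⟩ := Ideal.toCotangent_surjective _ x
    have hx : x.1 ∈ Submodule.span (MvPolynomial τ k) (Set.range f) := by
      rw [← Ideal.span, ← hI]; exact (SetLike.ext_iff.1 hker x.1).1 x.2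
    have : (1 : MvPolynomial τ k ⧸ I) = Submodule.Quotient.mk 1 := rfl
    simp only [LinearMap.comp_apply, KaehlerDifferential.kerCotangentToTensor_toCotangent,
      _root_.TensorProduct.lift.tmul, this, Submodule.liftQ_apply, LinearMap.id_apply]
    simpa using hD x hx x.2

/-- A derivation of `R` with values in a field `L` extends to `L` when `L` is formally smooth
over `R`. -/
theorem Derivation.exists_extend_of_formallySmooth {k R L : Type*} [CommRing k] [CommRing R]
    [Field L] [Algebra k R] [Algebra k L] [Algebra R L] [IsScalarTower k R L]
    [Algebra.FormallySmooth R L] (d : Derivation k R L) :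
    ∃ D : Derivation k L L, ∀ r, D (algebraMap R L r) = d r := by
  have hinj : Function.Injective (KaehlerDifferential.mapBaseChange k R L) := by
    rw [← LinearMap.ker_eq_bot, LinearMap.ker_eq_bot']
    intro x hx
    obtain ⟨y, rfl⟩ := (Algebra.H1Cotangent.exact_δ_mapBaseChange k R L x).1 hx
    rw [Subsingleton.elim y 0, map_zero]
  obtain ⟨g, hg⟩ := LinearMap.exists_leftInverse_of_injective _ (LinearMap.ker_eq_bot.2 hinj)
  refine ⟨((d.liftKaehlerDifferential.liftBaseChange L).comp g).compDer
    (KaehlerDifferential.D k L), fun r ↦ ?_⟩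
  have h := LinearMap.congr_fun hg (1 ⊗ₜ[R] KaehlerDifferential.D k R r)
  simp only [LinearMap.comp_apply, KaehlerDifferential.mapBaseChange_tmul,
    KaehlerDifferential.map_D, one_smul, LinearMap.id_apply] at h
  simp [h]

/-- If a matrix has linearly independent rows at every prime disjoint from a submonoid `S`, then it
has a right inverse up to a factor in `S`. -/
theorem Matrix.exists_mul_eq_smul_one_of_forall_prime {B : Type*} [CommRing B] {ι τ : Type*}
    [Fintype ι] [Fintype τ] [DecidableEq ι] (S : Submonoid B) (J : Matrix ι τ B)
    (hJ : ∀ (p : Ideal B) [p.IsPrime], Disjoint (p : Set B) S → ∀ v : ι → p.ResidueField,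
      Matrix.vecMul v (J.map (algebraMap B p.ResidueField)) = 0 → v = 0) :
    ∃ s ∈ S, ∃ N : Matrix τ ι B, J * N = s • (1 : Matrix ι ι B) := by
  classical
  let 𝔞 : Ideal B :=
    { carrier := {t | ∃ N : Matrix τ ι B, J * N = t • (1 : Matrix ι ι B)}
      add_mem' := by
        rintro a b ⟨N, hN⟩ ⟨N', hN'⟩
        exact ⟨N + N', by rw [Matrix.mul_add, hN, hN', add_smul]⟩
      zero_mem' := ⟨0, by simp⟩
      smul_mem' := by
        rintro c a ⟨N, hN⟩
        exact ⟨c • N, by rw [Matrix.mul_smul, hN, smul_smul, smul_eq_mul]⟩ }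
  by_contra hcon
  have hdisj : Disjoint (𝔞 : Set B) S := by
    rw [Set.disjoint_left]
    rintro s ⟨N, hN⟩ hs
    exact hcon ⟨s, hs, N, hN⟩
  obtain ⟨p, hp, hle, hpS⟩ := Ideal.exists_le_prime_disjoint 𝔞 S hdisj
  have hsurj : Function.Surjective (J.map (algebraMap B p.ResidueField)).mulVec := by
    have hrow : LinearIndependent p.ResidueField (J.map (algebraMap B p.ResidueField)).row := by
      rw [← Matrix.vecMul_injective_iff]
      intro v w hvw
      have := hJ p hpS (v - w) (by rw [Matrix.sub_vecMul]; exact sub_eq_zero.2 hvw)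
      exact sub_eq_zero.1 this
    have hrank := hrow.rank_matrix
    rw [Matrix.rank] at hrank
    exact LinearMap.range_eq_top.1 (Submodule.eq_top_of_finrank_eq
      (hrank.trans (Module.finrank_fintype_fun_eq_card _).symm))
  obtain ⟨N, hN⟩ := (Matrix.mulVec_surjective_iff_exists_right_inverse).1 hsurj
  obtain ⟨t, ht⟩ := IsLocalization.exist_integer_multiples_of_finset
    (M := nonZeroDivisors (B ⧸ p)) (Finset.univ.image fun q : τ × ι ↦ N q.1 q.2)
  have hint (b : τ) (r : ι) : ∃ n : B, algebraMap B p.ResidueField n =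
      algebraMap (B ⧸ p) p.ResidueField t * N b r := by
    obtain ⟨y, hy⟩ := ht (N b r) (Finset.mem_image_of_mem (fun q : τ × ι ↦ N q.1 q.2)
      (Finset.mem_univ (b, r)))
    obtain ⟨n, rfl⟩ := Ideal.Quotient.mk_surjective y
    refine ⟨n, ?_⟩
    rw [← Algebra.smul_def]
    exact hy
  choose N' hN' using hint
  have hmap : (J * Matrix.of N').map (algebraMap B p.ResidueField) =
      algebraMap (B ⧸ p) p.ResidueField t • (1 : Matrix ι ι p.ResidueField) := by
    rw [Matrix.map_mul, ← hN, ← Matrix.mul_smul]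
    congr 1
    ext b r
    simp [hN']
  have hdet : (J * Matrix.of N').det ∈ p :=
    hle ⟨Matrix.of N' * (J * Matrix.of N').adjugate, by
      rw [← Matrix.mul_assoc, Matrix.mul_adjugate]⟩
  rw [← Ideal.algebraMap_residueField_eq_zero, RingHom.map_det, RingHom.mapMatrix_apply, hmap,
    Matrix.det_smul, Matrix.det_one, mul_one] at hdet
  have ht0 : algebraMap (B ⧸ p) p.ResidueField t = 0 := eq_zero_of_pow_eq_zero hdet
  rw [map_eq_zero_iff _ (IsFractionRing.injective (B ⧸ p) p.ResidueField)] at ht0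
  exact nonZeroDivisors.coe_ne_zero t ht0

/-- A right inverse up to a scalar becomes a right inverse once that scalar becomes a unit. -/
theorem Matrix.mul_smul_map_eq_one {A B : Type*} [CommRing A] [CommRing B] {ι τ : Type*}
    [Fintype ι] [Fintype τ] [DecidableEq ι] (ψ : A →+* B) {J : Matrix ι τ A} {N : Matrix τ ι A}
    {d : A} (h : J * N = d • 1) {J' : Matrix ι τ B} (hJ : J' = J.map ψ) {u : B}
    (hu : u * ψ d = 1) : J' * (u • N.map ψ) = 1 := by
  rw [hJ, Matrix.mul_smul, ← Matrix.map_mul, h]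
  ext s r
  by_cases hsr : s = r <;> simp [Matrix.one_apply, hsr, hu]

/-- In characteristic zero, a residue field of a finite type algebra over a domain `R` which lies
over the generic point of `R` is formally smooth over `R`. -/
theorem Ideal.formallySmooth_residueField {R B : Type*} [CommRing R] [IsDomain R] [CharZero R]
    [CommRing B] [Algebra R B] [Algebra.FiniteType R B] (p : Ideal B) [p.IsPrime]
    (hinj : Function.Injective (algebraMap R p.ResidueField)) :
    Algebra.FormallySmooth R p.ResidueField := by
  have : FaithfulSMul R p.ResidueField := (faithfulSMul_iff_algebraMap_injective _ _).2 hinj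
  have : Algebra.EssFiniteType R p.ResidueField := Algebra.EssFiniteType.comp R B _
  let := FractionRing.liftAlgebra R p.ResidueField
  have : IsScalarTower R (FractionRing R) p.ResidueField := inferInstance
  have : Algebra.EssFiniteType (FractionRing R) p.ResidueField :=
    Algebra.EssFiniteType.of_comp R _ _
  have : CharZero (FractionRing R) := inferInstance
  have : Algebra.FormallySmooth R (FractionRing R) :=
    Algebra.FormallySmooth.of_isLocalization (nonZeroDivisors R)
  exact Algebra.FormallySmooth.comp R (FractionRing R) _

namespace CyclicCover

open MvPolynomial

variable {σ κ S : Type*} [CommRing S]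

/-- The equations `vⱼ ^ Mⱼ = gⱼ(x)` and `xᵢ = 1` of the `i`-th standard chart of an iterated cyclic
cover. -/
noncomputable def chartRel (M : κ → ℕ) (g : κ → MvPolynomial σ S) (i : σ) :
    κ ⊕ Unit → MvPolynomial (σ ⊕ κ) S :=
  Sum.elim (fun j ↦ X (Sum.inr j) ^ M j - rename Sum.inl (g j)) (fun _ ↦ X (Sum.inl i) - 1)

theorem map_chartRel {S' : Type*} [CommRing S'] (φ : S →+* S') (M : κ → ℕ)
    (g : κ → MvPolynomial σ S) (i : σ) (s : κ ⊕ Unit) :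
    map φ (chartRel M g i s) = chartRel M (fun j ↦ map φ (g j)) i s := by
  rcases s with j | _ <;> simp [chartRel, map_rename]

theorem pderiv_chartRel_inr [DecidableEq κ] [DecidableEq σ] (M : κ → ℕ)
    (g : κ → MvPolynomial σ S) (i : σ) (b : σ ⊕ κ) :
    pderiv b (chartRel M g i (Sum.inr ())) = if b = Sum.inl i then 1 else 0 := by
  simp [chartRel, pderiv_X, Pi.single_apply, eq_comm]

variable [Fintype σ]

/-- The Fermat-type form `∑ₗ cₗ xₗ ^ m`. -/
noncomputable def fermat (m : ℕ) (c : σ → S) : MvPolynomial σ S :=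
  ∑ l, C (c l) * X l ^ m

theorem fermat_isHomogeneous (m : ℕ) (c : σ → S) : (fermat m c).IsHomogeneous m := by
  refine IsHomogeneous.sum _ _ _ fun l _ ↦ ?_
  simpa using (isHomogeneous_C σ (c l)).mul ((isHomogeneous_X S l).pow m)

theorem map_fermat {S' : Type*} [CommRing S'] (φ : S →+* S') (m : ℕ) (c : σ → S) :
    map φ (fermat m c) = fermat m (φ ∘ c) := by
  simp [fermat]

/-- If a derivation detects only the coefficient of `xᵢ ^ Mⱼ` in the `j`-th equation, then the
`j`-th row of the Jacobian matrix occurs with coefficient zero in each relation between the rows. -/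
theorem eq_zero_of_derivation {k L : Type*} [CommRing k] [Field L] [Algebra k L] [Fintype κ]
    [DecidableEq κ] [DecidableEq σ] (D : Derivation k L L) {M : κ → ℕ} {x : σ → L} {v : κ → L}
    {c : κ → σ → L} {i : σ} {j₀ : κ} (hv : ∀ j, v j ^ M j = ∑ l, c j l * x l ^ M j)
    (hx : x i = 1) (hc : ∀ j l, D (c j l) = if j = j₀ ∧ l = i then 1 else 0)
    {w : κ → L} {μ : L} (h₁ : ∀ j, w j * (M j * v j ^ (M j - 1)) = 0)
    (h₂ : ∀ l, ∑ j, w j * (c j l * (M j * x l ^ (M j - 1))) = if l = i then μ else 0) :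
    w j₀ = 0 := by
  have hDx : D (x i) = 0 := by rw [hx, D.map_one_eq_zero]
  have hD (j : κ) : M j * v j ^ (M j - 1) * D (v j) =
      (if j = j₀ then 1 else 0) + ∑ l, c j l * (M j * x l ^ (M j - 1)) * D (x l) := by
    have h := congrArg D (hv j)
    simp only [Derivation.leibniz_pow, map_sum, Derivation.leibniz, hc, smul_eq_mul,
      nsmul_eq_mul, Finset.sum_add_distrib, mul_ite, mul_one, mul_zero] at h
    have h' : (∑ l, if j = j₀ ∧ l = i then x l ^ M j else 0) = if j = j₀ then 1 else 0 := by
      split_ifs with hj <;> simp [hj, hx]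
    rw [h', add_comm] at h
    rw [mul_assoc, h]
    congr 1
    exact Finset.sum_congr rfl fun l _ ↦ by ring
  have h0 : ∑ j, w j * (M j * v j ^ (M j - 1) * D (v j)) = 0 :=
    Finset.sum_eq_zero fun j _ ↦ by rw [← mul_assoc, h₁, zero_mul]
  simp only [hD, mul_add, Finset.sum_add_distrib, Finset.mul_sum] at h0
  rw [Finset.sum_comm (s := Finset.univ (α := κ))] at h0
  have h₃ (l : σ) : ∑ j, w j * (c j l * (M j * x l ^ (M j - 1)) * D (x l)) = 0 := by
    have : ∑ j, w j * (c j l * (M j * x l ^ (M j - 1)) * D (x l)) =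
        (if l = i then μ else 0) * D (x l) := by
      rw [← h₂ l, Finset.sum_mul]
      exact Finset.sum_congr rfl fun j _ ↦ by ring
    rw [this]
    split_ifs with h
    · rw [h, hDx, mul_zero]
    · rw [zero_mul]
  simpa [h₃] using h0

theorem pderiv_inl_chartRel (M : κ → ℕ) (c : κ → σ → S) (i l : σ)
    (j : κ) : pderiv (Sum.inl l) (chartRel M (fun j ↦ fermat (M j) (c j)) i (Sum.inl j)) =
      - (C (c j l) * ((M j : MvPolynomial (σ ⊕ κ) S) * X (Sum.inl l) ^ (M j - 1))) := by
  classical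
  simp [chartRel, fermat, Derivation.leibniz_pow, pderiv_X, Pi.single_apply]

theorem pderiv_inr_chartRel [DecidableEq κ] (M : κ → ℕ) (c : κ → σ → S) (i : σ)
    (j j' : κ) : pderiv (Sum.inr j') (chartRel M (fun j ↦ fermat (M j) (c j)) i (Sum.inl j)) =
      if j' = j then (M j : MvPolynomial (σ ⊕ κ) S) * X (Sum.inr j) ^ (M j - 1) else 0 := by
  rcases eq_or_ne j' j with rfl | h
  · simp [chartRel, fermat, Derivation.leibniz_pow]
  · have : pderiv (Sum.inr j') (X (Sum.inr j) : MvPolynomial (σ ⊕ κ) S) = 0 :=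
      pderiv_X_of_ne fun h' ↦ h (Sum.inr_injective h').symm
    simp [chartRel, fermat, Derivation.leibniz_pow, h, this]

/-- The generic Fermat-type equations have a Jacobian matrix of full rank up to inverting a nonzero
polynomial in the coefficients. -/
theorem exists_generic_right_inverse (k : Type*) [Field k] [CharZero k] [Fintype κ]
    [DecidableEq κ] [DecidableEq σ] (M : κ → ℕ) (i : σ) {B : Type*} [CommRing B] [Algebra k B]
    [Algebra (MvPolynomial (κ × σ) k) B] [IsScalarTower k (MvPolynomial (κ × σ) k) B]
    [Algebra.FiniteType (MvPolynomial (κ × σ) k) B]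
    (φ : MvPolynomial (σ ⊕ κ) (MvPolynomial (κ × σ) k) →ₐ[MvPolynomial (κ × σ) k] B)
    (hφ : ∀ s, φ (chartRel M
      (fun j ↦ fermat (M j) fun l ↦ (X (j, l) : MvPolynomial (κ × σ) k)) i s) = 0) :
    ∃ d : MvPolynomial (κ × σ) k, d ≠ 0 ∧ ∃ N : Matrix (σ ⊕ κ) (κ ⊕ Unit) B,
      Matrix.of (fun s b ↦ φ (pderiv b (chartRel M
        (fun j ↦ fermat (M j) fun l ↦ (X (j, l) : MvPolynomial (κ × σ) k)) i s))) * N =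
        algebraMap (MvPolynomial (κ × σ) k) B d • (1 : Matrix (κ ⊕ Unit) (κ ⊕ Unit) B) := by
  suffices h : ∃ s ∈ Algebra.algebraMapSubmonoid B (nonZeroDivisors (MvPolynomial (κ × σ) k)),
      ∃ N : Matrix (σ ⊕ κ) (κ ⊕ Unit) B, Matrix.of (fun s b ↦ φ (pderiv b (chartRel M
        (fun j ↦ fermat (M j) fun l ↦ (X (j, l) : MvPolynomial (κ × σ) k)) i s))) * N =
        s • (1 : Matrix (κ ⊕ Unit) (κ ⊕ Unit) B) by
    obtain ⟨_, ⟨d, hd, rfl⟩, N, hN⟩ := h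
    exact ⟨d, nonZeroDivisors.ne_zero hd, N, hN⟩
  refine Matrix.exists_mul_eq_smul_one_of_forall_prime _ _ ?_
  intro p hp hdisj w hw
  have hinj : Function.Injective (algebraMap (MvPolynomial (κ × σ) k) p.ResidueField) := by
    rw [injective_iff_map_eq_zero]
    intro r hr
    by_contra hr0
    rw [IsScalarTower.algebraMap_apply _ B p.ResidueField,
      Ideal.algebraMap_residueField_eq_zero] at hr
    exact Set.disjoint_left.1 hdisj hr ⟨r, mem_nonZeroDivisors_of_ne_zero hr0, rfl⟩
  have := p.formallySmooth_residueField hinj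
  let ρ : MvPolynomial (σ ⊕ κ) (MvPolynomial (κ × σ) k) →+* p.ResidueField :=
    (algebraMap B p.ResidueField).comp (φ : _ →+* B)
  have hρC (r : MvPolynomial (κ × σ) k) : ρ (C r) = algebraMap _ p.ResidueField r := by
    have : φ (C r) = algebraMap _ B r := φ.commutes r
    simp [ρ, this, ← IsScalarTower.algebraMap_apply]
  have hρ0 (s) : ρ (chartRel M
      (fun j ↦ fermat (M j) fun l ↦ (X (j, l) : MvPolynomial (κ × σ) k)) i s) = 0 := by
    simp [ρ, hφ]
  have hrow (b) : ∑ s, w s * ρ (pderiv b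
      (chartRel M (fun j ↦ fermat (M j) fun l ↦ (X (j, l) : MvPolynomial (κ × σ) k)) i s)) = 0 :=
    congrFun hw b
  simp only [Fintype.sum_sum_type, Finset.univ_unique, Finset.sum_singleton, PUnit.default_eq_unit,
    pderiv_chartRel_inr] at hrow
  have hw1 (j : κ) : w (Sum.inl j) = 0 := by
    obtain ⟨D, hD⟩ := Derivation.exists_extend_of_formallySmooth
      (mkDerivation k (fun q : κ × σ ↦ if q = (j, i) then (1 : p.ResidueField) else 0))
    refine eq_zero_of_derivation D (M := M) (x := fun l ↦ ρ (X (Sum.inl l)))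
      (v := fun j ↦ ρ (X (Sum.inr j)))
      (c := fun j l ↦ algebraMap (MvPolynomial (κ × σ) k) p.ResidueField (X (j, l)))
      (i := i) (w := fun j ↦ w (Sum.inl j)) (μ := w (Sum.inr ())) ?_ ?_ ?_ ?_ ?_
    · intro j
      have h := hρ0 (Sum.inl j)
      simp only [chartRel, fermat, Sum.elim_inl, map_sub, map_sum, map_mul, map_pow, rename_C,
        rename_X, hρC, sub_eq_zero] at h
      exact h
    · have h := hρ0 (Sum.inr ())
      simpa [chartRel, sub_eq_zero] using h
    · intro j l
      simp [hD, mkDerivation_X]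
    · intro j
      have h := hrow (Sum.inr j)
      simpa [pderiv_inr_chartRel, apply_ite ρ] using h
    · intro l
      have h := hrow (Sum.inl l)
      simp only [pderiv_inl_chartRel, map_neg, mul_neg, Finset.sum_neg_distrib, map_mul, map_pow,
        map_natCast, hρC, apply_ite ρ, Sum.inl.injEq, map_one, map_zero, mul_ite, mul_one,
        mul_zero] at h
      rw [neg_add_eq_zero] at h
      exact h
  ext s
  rcases s with j | _
  · exact hw1 j
  · simpa [hw1] using hrow (Sum.inl i)

/-- Fermat-type equations with general coefficients define smooth charts. -/
theorem exists_smooth_charts (k : Type*) [Field k] [CharZero k] [Fintype κ]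
    (M : κ → ℕ) : ∃ c : κ → σ → k, ∀ (i : σ) (I : Ideal (MvPolynomial (σ ⊕ κ) k)),
      I = Ideal.span (Set.range (chartRel M (fun j ↦ fermat (M j) (c j)) i)) →
      Algebra.Smooth k (MvPolynomial (σ ⊕ κ) k ⧸ I) := by
  classical
  choose d hd N hN using fun i : σ ↦ exists_generic_right_inverse k M i
    (Ideal.Quotient.mkₐ _ (Ideal.span (Set.range (chartRel M
      (fun j ↦ fermat (M j) fun l ↦ (X (j, l) : MvPolynomial (κ × σ) k)) i))))
    fun s ↦ Ideal.Quotient.eq_zero_iff_mem.2 (Ideal.subset_span ⟨s, rfl⟩)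
  have hprod : ∏ i, d i ≠ 0 := Finset.prod_ne_zero_iff.2 fun i _ ↦ hd i
  obtain ⟨c, hc⟩ : ∃ c, eval c (∏ i, d i) ≠ 0 := by
    by_contra! h
    exact hprod (MvPolynomial.funext fun c ↦ by rw [h, map_zero])
  rw [map_prod, Finset.prod_ne_zero_iff] at hc
  refine ⟨fun j l ↦ c (j, l), fun i I hI ↦ ?_⟩
  have hmap (s) : map (eval c) (chartRel M
      (fun j ↦ fermat (M j) fun l ↦ (X (j, l) : MvPolynomial (κ × σ) k)) i s) =
      chartRel M (fun j ↦ fermat (M j) fun l ↦ c (j, l)) i s := by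
    rw [map_chartRel]
    refine congrArg (fun g ↦ chartRel M g i s) (funext fun j ↦ ?_)
    rw [map_fermat]
    refine congrArg (fermat (M j)) (funext fun l ↦ ?_)
    simp
  let ψ := Ideal.quotientMap (I := Ideal.span (Set.range (chartRel M
    (fun j ↦ fermat (M j) fun l ↦ (X (j, l) : MvPolynomial (κ × σ) k)) i))) I (map (eval c)) (by
      rw [Ideal.span_le]
      rintro _ ⟨s, rfl⟩
      rw [SetLike.mem_coe, Ideal.mem_comap, hmap, hI]
      exact Ideal.subset_span ⟨s, rfl⟩)
  refine Algebra.Smooth.of_jacobian_mul_eq_one _ hI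
    (Ideal.Quotient.mk I (C (eval c (d i))⁻¹) • (N i).map ψ) ?_
  refine Matrix.mul_smul_map_eq_one ψ (hN i) ?_ ?_
  · ext s b
    simp only [Matrix.of_apply, Matrix.map_apply, ψ, Ideal.Quotient.mkₐ_eq_mk,
      Ideal.quotientMap_mk, ← pderiv_map, hmap]
  · change _ * ψ (Ideal.Quotient.mk _ (C (d i))) = 1
    rw [Ideal.quotientMap_mk, map_C, ← map_mul, ← map_mul,
      inv_mul_cancel₀ (hc i (Finset.mem_univ i)), map_one, map_one]

/-- A standard chart of an iterated cyclic cover is finite over affine space, hence has the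
expected dimension. -/
theorem ringKrullDim_chart (k : Type*) [Field k] [Finite κ] [DecidableEq σ] {M : κ → ℕ}
    (hM : ∀ j, 0 < M j) (g : κ → MvPolynomial σ k) (i : σ) (I : Ideal (MvPolynomial (σ ⊕ κ) k))
    (hI : I = Ideal.span (Set.range (chartRel M g i))) :
    ringKrullDim (MvPolynomial (σ ⊕ κ) k ⧸ I) = Nat.card {l : σ // l ≠ i} := by
  have hrel (s) : Ideal.Quotient.mk I (chartRel M g i s) = 0 :=
    Ideal.Quotient.eq_zero_iff_mem.2 (hI ▸ Ideal.subset_span ⟨s, rfl⟩)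
  let f : MvPolynomial {l : σ // l ≠ i} k →ₐ[k] MvPolynomial (σ ⊕ κ) k ⧸ I :=
    aeval fun l ↦ Ideal.Quotient.mk I (X (Sum.inl l.1))
  let e : σ → MvPolynomial {l : σ // l ≠ i} k := fun l ↦ if h : l = i then 1 else X ⟨l, h⟩
  have hfe (l : σ) : f (e l) = Ideal.Quotient.mk I (X (Sum.inl l)) := by
    by_cases h : l = i
    · subst h
      have := hrel (Sum.inr ())
      simp only [chartRel, Sum.elim_inr, map_sub, map_one, sub_eq_zero] at this
      simp [e, this]
    · simp [e, h, f]
  have hfg (p : MvPolynomial σ k) : f (aeval e p) = Ideal.Quotient.mk I (rename Sum.inl p) := by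
    have : f.comp (aeval e) = (Ideal.Quotient.mkₐ k I).comp (rename Sum.inl) := by
      ext l
      simp [hfe]
    exact DFunLike.congr_fun this p
  have hint : f.toRingHom.IsIntegral := by
    intro y
    obtain ⟨p, rfl⟩ := Ideal.Quotient.mk_surjective y
    induction p using MvPolynomial.induction_on with
    | C a =>
      have : Ideal.Quotient.mk I (C a) = f.toRingHom (C a) := by simp [f]; rfl
      rw [this]
      exact f.toRingHom.isIntegralElem_map
    | add p q hp hq => rw [map_add]; exact hp.add _ hq
    | mul_X p b hp =>
      rw [map_mul]
      refine hp.mul _ ?_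
      rcases b with l | j
      · rw [← hfe]
        exact f.toRingHom.isIntegralElem_map
      · let := f.toRingHom.toAlgebra
        refine IsIntegral.of_pow (R := MvPolynomial {l : σ // l ≠ i} k) (hM j) ?_
        have := hrel (Sum.inl j)
        simp only [chartRel, Sum.elim_inl, map_sub, map_pow, sub_eq_zero] at this
        rw [this, ← hfg]
        exact f.toRingHom.isIntegralElem_map
  have hinj : Function.Injective f.toRingHom := by
    let Ω := AlgebraicClosure (FractionRing (MvPolynomial {l : σ // l ≠ i} k))
    have hΩ : Function.Injective (algebraMap (MvPolynomial {l : σ // l ≠ i} k) Ω) := by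
      rw [IsScalarTower.algebraMap_eq _ (FractionRing (MvPolynomial {l : σ // l ≠ i} k)) Ω]
      exact (algebraMap (FractionRing (MvPolynomial {l : σ // l ≠ i} k)) Ω).injective.comp
        (IsFractionRing.injective _ _)
    choose v hv using fun j ↦ IsAlgClosed.exists_pow_nat_eq
      (algebraMap (MvPolynomial {l : σ // l ≠ i} k) Ω (aeval e (g j))) (hM j)
    let Φ : MvPolynomial (σ ⊕ κ) k →ₐ[k] Ω := aeval (Sum.elim (fun l ↦ algebraMap _ Ω (e l)) v)
    have hΦ (p : MvPolynomial σ k) : Φ (rename Sum.inl p) = algebraMap _ Ω (aeval e p) := by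
      have : Φ.comp (rename Sum.inl) = (IsScalarTower.toAlgHom k _ Ω).comp (aeval e) := by
        ext l
        simp [Φ]
      exact DFunLike.congr_fun this p
    have hΦI (p) (hp : p ∈ I) : Φ p = 0 := by
      have : I ≤ RingHom.ker Φ := by
        rw [hI, Ideal.span_le]
        rintro _ ⟨j | _, rfl⟩
        · simp [chartRel, hΦ, hv, Φ, RingHom.mem_ker]
        · simp [chartRel, Φ, e, RingHom.mem_ker]
      exact this hp
    let Ψ := Ideal.Quotient.liftₐ I Φ hΦI
    have hcomp : Ψ.comp f = IsScalarTower.toAlgHom k _ Ω := by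
      ext l
      have : f (X l) = Ideal.Quotient.mk I (X (Sum.inl l.1)) := aeval_X _ _
      rw [AlgHom.comp_apply, this]
      change Φ (X (Sum.inl l.1)) = _
      simp [Φ, e, l.2]
    refine Function.Injective.of_comp (f := Ψ) ?_
    have : (Ψ ∘ f.toRingHom) = algebraMap _ Ω := by
      ext p
      exact DFunLike.congr_fun hcomp p
    rw [this]
    exact hΩ
  rw [hint.ringKrullDim_eq hinj, MvPolynomial.ringKrullDim_of_isNoetherianRing]
  simp

end CyclicCover

/-- Let `M₁, …, M_a` be positive integers and `n ≥ 0`. Over a field `k`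
of characteristic zero there exist homogeneous polynomials `g₁, …, g_a ∈ k[x₀, …, x_n]`
with `deg g_i = M_i` such that the projective variety
`Proj k[x₀,…,x_n, v₁,…,v_a] / (v₁^{M₁} − g₁, …, v_a^{M_a} − g_a)`
is smooth over `k` of dimension `n`.

Since (using the relations) this variety is covered by the standard charts `D₊(x_i)`,
`0 ≤ i ≤ n`, smoothness and the dimension are expressed on the affine charts
`D₊(x_i) = Spec (k[x, v]/(relations, x_i − 1))`. -/
theorem stmt17_smooth_iterated_cyclic_cover_exists
    (k : Type u) [Field k] [CharZero k]
    (n a : ℕ) (M : Fin a → ℕ) (hM : ∀ j, 0 < M j) :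
    ∃ g : Fin a → MvPolynomial (Fin (n + 1)) k,
      (∀ j, (g j).IsHomogeneous (M j)) ∧
      ∀ i : Fin (n + 1),
        Algebra.Smooth k
          (MvPolynomial (Fin (n + 1) ⊕ Fin a) k ⧸
            (Ideal.span ((Set.range fun j : Fin a =>
                (MvPolynomial.X (Sum.inr j) : MvPolynomial (Fin (n + 1) ⊕ Fin a) k) ^ M j
                  - MvPolynomial.rename Sum.inl (g j)) ∪
              {MvPolynomial.X (Sum.inl i) - 1}))) ∧
        ringKrullDim
          (MvPolynomial (Fin (n + 1) ⊕ Fin a) k ⧸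
            (Ideal.span ((Set.range fun j : Fin a =>
                (MvPolynomial.X (Sum.inr j) : MvPolynomial (Fin (n + 1) ⊕ Fin a) k) ^ M j
                  - MvPolynomial.rename Sum.inl (g j)) ∪
              {MvPolynomial.X (Sum.inl i) - 1}))) = n := by
  obtain ⟨c, hc⟩ := CyclicCover.exists_smooth_charts (σ := Fin (n + 1)) k M
  refine ⟨fun j ↦ CyclicCover.fermat (M j) (c j),
    fun j ↦ CyclicCover.fermat_isHomogeneous _ _, fun i ↦ ?_⟩
  have hI : Ideal.span ((Set.range fun j : Fin a ↦
      (MvPolynomial.X (Sum.inr j) : MvPolynomial (Fin (n + 1) ⊕ Fin a) k) ^ M j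
        - MvPolynomial.rename Sum.inl (CyclicCover.fermat (M j) (c j))) ∪
      {MvPolynomial.X (Sum.inl i) - 1}) = Ideal.span (Set.range
        (CyclicCover.chartRel M (fun j ↦ CyclicCover.fermat (M j) (c j)) i)) := by
    rw [CyclicCover.chartRel, Set.Sum.elim_range, Set.range_const]
  refine ⟨hc i _ hI, ?_⟩
  rw [CyclicCover.ringKrullDim_chart k hM _ i _ hI]
  simp
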